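/- Let p ∈ 𝕊^M and t > 0. There exist a unique intensity vector λ = (λ₂,…,λ_{M−1}) with λ_j ≥ 0, α ∈ (0,1], l ∈ {2,…,M} and β ∈ (0,1] such that for every h > 0 with hλ_j(1+k̃_j) ≤ 1 for all j, setting a = t/(t+h), the matrix I − a·P̃^{(h)}(λ) is invertible and for every j ∈ {1,…,M}: (1−a)·[(1−β)·((I − a·P̃^{(h)}(λ))^{−1})_{l−1,j} + β·((I − a·P̃^{(h)}(λ))^{−1})_{l,j}] = α·p_j. Moreover α = 1/(1 + t∑_{j=1}^M p_jλ_j k̃_j) (with λ₁ = λ_M = 0), β = (x₀ − κ_{l−1})/(κ_l − κ_{l−1}) where x₀ = (∑_{j=1}^M κ_j p_j(1+tλ_j k̃_j))/(∑_{j=1}^M p_j(1+tλ_j k̃_j)), and ((λ₁,…,λ_M), l) solves the G-system with time parameter t and probability vector p. -/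

import Mathlib

noncomputable section

open Finset MeasureTheory

/-- Paper index `j ∈ {1,…,M+1}` as an element of `Fin (M+1)`. -/
def fid (M j : ℕ) : Fin (M + 1) := ⟨(j - 1) % (M + 1), Nat.mod_lt _ (Nat.succ_pos M)⟩

/-- `q_{j,j+1}` built from the grid `i` and the drift `b`. -/
def qup (i b : ℕ → ℝ) (j : ℕ) : ℝ :=
  ((i j - i (j - 1)) / (i (j + 1) - i (j - 1))) * (1 + (i (j + 1) - i j) * b j)

/-- `q_{j,j-1}` built from the grid `i` and the drift `b`. -/
def qdn (i b : ℕ → ℝ) (j : ℕ) : ℝ :=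
  ((i (j + 1) - i j) / (i (j + 1) - i (j - 1))) * (1 - (i j - i (j - 1)) * b j)

/-- `k̃_j = (i_{j+1}-i_j)(i_j-i_{j-1}) k_j` for `2 ≤ j ≤ M-1`, and `0` otherwise. -/
def ktil (M : ℕ) (i k : ℕ → ℝ) (j : ℕ) : ℝ :=
  if 2 ≤ j ∧ j ≤ M - 1 then (i (j + 1) - i j) * (i j - i (j - 1)) * k j else 0

/-- The drift hypothesis `-1/(i_{j+1}-i_j) < b_j < 1/(i_j - i_{j-1})`. -/
def DriftHyp (M : ℕ) (i b : ℕ → ℝ) : Prop :=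
  ∀ j, 2 ≤ j → j ≤ M - 1 →
    -(1 / (i (j + 1) - i j)) < b j ∧ b j < 1 / (i j - i (j - 1))

/-- An intensity vector: nonnegative on `{2,…,M-1}` and (by convention) `0` elsewhere. -/
def IntensityVec (M : ℕ) (lam : ℕ → ℝ) : Prop :=
  (∀ j, 2 ≤ j → j ≤ M - 1 → 0 ≤ lam j) ∧ (∀ j, ¬(2 ≤ j ∧ j ≤ M - 1) → lam j = 0)

/-- `p ∈ 𝕊^M`. -/
def ProbVec (M : ℕ) (p : ℕ → ℝ) : Prop :=
  (∀ j, 1 ≤ j → j ≤ M → 0 < p j) ∧ ∑ j ∈ Finset.Icc 1 M, p j = 1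

/-- `κ` are martingale coordinates for `(i,b)`. -/
def MartCoord (M : ℕ) (i b κ : ℕ → ℝ) : Prop :=
  (∀ j, 1 ≤ j → j ≤ M - 1 → κ j < κ (j + 1)) ∧
  (∀ j, 2 ≤ j → j ≤ M - 1 →
    qup i b j = (κ j - κ (j - 1)) / (κ (j + 1) - κ (j - 1)) ∧
    qdn i b j = (κ (j + 1) - κ j) / (κ (j + 1) - κ (j - 1)))

/-- The point `x₀` of the G-system. -/
def Gx0 (M : ℕ) (s : ℝ) (κ kt P G : ℕ → ℝ) : ℝ :=
  (∑ j ∈ Finset.Icc 1 M, κ j * P j * (1 + s * G j * kt j)) /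
    (∑ j ∈ Finset.Icc 1 M, P j * (1 + s * G j * kt j))

/-- `(G, l)` solves the G-system with time parameter `s` and probability vector `P`. -/
def GSystem (M : ℕ) (s : ℝ) (κ kt P G : ℕ → ℝ) (l : ℕ) : Prop :=
  2 ≤ l ∧ l ≤ M ∧
  (∀ j, 1 ≤ j → j ≤ M → 0 ≤ G j) ∧ G 1 = 0 ∧ G M = 0 ∧
  κ (l - 1) < Gx0 M s κ kt P G ∧ Gx0 M s κ kt P G ≤ κ l ∧
  (∀ j, 2 ≤ j → j ≤ l - 1 →
    G j = (1 / (s * P j)) *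
      ((κ (j + 1) - κ (j - 1)) / ((κ (j + 1) - κ j) * (κ j - κ (j - 1)))) *
      ∑ a ∈ Finset.Icc 1 (j - 1), (κ j - κ a) * P a * (1 + s * G a * kt a)) ∧
  (∀ j, l ≤ j → j ≤ M - 1 →
    G j = (1 / (s * P j)) *
      ((κ (j + 1) - κ (j - 1)) / ((κ (j + 1) - κ j) * (κ j - κ (j - 1)))) *
      ∑ a ∈ Finset.Icc (j + 1) M, (κ a - κ j) * P a * (1 + s * G a * kt a))

/-- Entry `(j,c)` (paper indices in `{1,…,M+1}`) of the matrix `Ñ_t(λ)`. -/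
def NtE (M : ℕ) (t : ℝ) (i b k lam : ℕ → ℝ) (j c : ℕ) : ℝ :=
  if 2 ≤ j ∧ j ≤ M - 1 then
    if c = j then 1 + t * lam j * (1 + ktil M i k j)
    else if c = j + 1 then -(t * lam j * qup i b j)
    else if c = j - 1 then -(t * lam j * qdn i b j)
    else if c = M + 1 then -(t * lam j * ktil M i k j)
    else 0
  else if c = j then 1 else 0

/-- The `(M+1)×(M+1)` matrix `Ñ_t(λ)`. -/
def Ntilde (M : ℕ) (t : ℝ) (i b k lam : ℕ → ℝ) : Matrix (Fin (M + 1)) (Fin (M + 1)) ℝ :=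
  Matrix.of fun u v => NtE M t i b k lam (u.1 + 1) (v.1 + 1)

/-- The top-left `M×M` block `N_t(λ)` of `Ñ_t(λ)`. -/
def NMat (M : ℕ) (t : ℝ) (i b k lam : ℕ → ℝ) : Matrix (Fin M) (Fin M) ℝ :=
  Matrix.of fun u v => NtE M t i b k lam (u.1 + 1) (v.1 + 1)

/-- Entry `(j,c)` (paper indices) of the one-step transition matrix `P̃^{(h)}(λ)`. -/
def PtE (M : ℕ) (h : ℝ) (i b k lam : ℕ → ℝ) (j c : ℕ) : ℝ :=
  if 2 ≤ j ∧ j ≤ M - 1 then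
    if c = j then 1 - h * lam j * (1 + ktil M i k j)
    else if c = j + 1 then h * lam j * qup i b j
    else if c = j - 1 then h * lam j * qdn i b j
    else if c = M + 1 then h * lam j * ktil M i k j
    else 0
  else if c = j then 1 else 0

/-- The `(M+1)×(M+1)` transition matrix `P̃^{(h)}(λ)`. -/
def Ptilde (M : ℕ) (h : ℝ) (i b k lam : ℕ → ℝ) : Matrix (Fin (M + 1)) (Fin (M + 1)) ℝ :=
  Matrix.of fun u v => PtE M h i b k lam (u.1 + 1) (v.1 + 1)

/-- Entry `(j,c)` (paper indices) of the intensity matrix `Θ(λ)`. -/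
def ThE (M : ℕ) (i b k lam : ℕ → ℝ) (j c : ℕ) : ℝ :=
  if 2 ≤ j ∧ j ≤ M - 1 then
    if c = j then -(lam j * (1 + ktil M i k j))
    else if c = j + 1 then lam j * qup i b j
    else if c = j - 1 then lam j * qdn i b j
    else if c = M + 1 then lam j * ktil M i k j
    else 0
  else 0

/-- The `(M+1)×(M+1)` intensity matrix `Θ(λ)`. -/
def Theta (M : ℕ) (i b k lam : ℕ → ℝ) : Matrix (Fin (M + 1)) (Fin (M + 1)) ℝ :=
  Matrix.of fun u v => ThE M i b k lam (u.1 + 1) (v.1 + 1)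


/-- The solution property of Statement 2 (geometric stopping): for every admissible step
length `h`, with `a = t/(t+h)`, the matrix `I - a·P̃^{(h)}(λ)` is invertible and the chain
started from the randomized initial condition on `{i_{l-1}, i_l}` and stopped at an
independent geometric time of mean `t` has distribution `α·p`. -/
def Sol2 (M : ℕ) (t : ℝ) (i b k κ p lam : ℕ → ℝ) (α : ℝ) (l : ℕ) (β : ℝ) : Prop :=
  IntensityVec M lam ∧ 0 < α ∧ α ≤ 1 ∧ 2 ≤ l ∧ l ≤ M ∧ 0 < β ∧ β ≤ 1 ∧
  ∀ h : ℝ, 0 < h → (∀ j, 1 ≤ j → j ≤ M → h * lam j * (1 + ktil M i k j) ≤ 1) →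
    IsUnit (1 - (t / (t + h)) • Ptilde M h i b k lam) ∧
    ∀ j, 1 ≤ j → j ≤ M →
      (1 - t / (t + h)) *
          ((1 - β) *
              (1 - (t / (t + h)) • Ptilde M h i b k lam)⁻¹ (fid M (l - 1)) (fid M j)
            + β * (1 - (t / (t + h)) • Ptilde M h i b k lam)⁻¹ (fid M l) (fid M j))
        = α * p j

/-! ### Discrete potentials on a grid -/

theorem sum_Icc_sub_mul_eq {M j : ℕ} (hj : 1 ≤ j) (hjM : j ≤ M) (κ w : ℕ → ℝ) :
    ∑ a ∈ Finset.Icc 1 M, (κ a - κ j) * w a =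
      ∑ a ∈ Finset.Ioc j M, (κ a - κ j) * w a - ∑ a ∈ Finset.Ico 1 j, (κ j - κ a) * w a := by
  rw [← Finset.Ico_add_one_right_eq_Icc, ← Finset.Ico_add_one_add_one_eq_Ioc,
    ← Finset.sum_Ico_consecutive _ hj (by omega : j ≤ M + 1),
    Finset.sum_eq_sum_Ico_succ_bot (by omega : j < M + 1)]
  have : ∑ a ∈ Finset.Ico 1 j, (κ a - κ j) * w a
      = -∑ a ∈ Finset.Ico 1 j, (κ j - κ a) * w a := by
    rw [← Finset.sum_neg_distrib]
    exact Finset.sum_congr rfl fun a _ => by ring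
  rw [this]
  ring

theorem sum_Ico_succ_sub_mul {j : ℕ} (hj : 1 ≤ j) (κ w : ℕ → ℝ) :
    ∑ a ∈ Finset.Ico 1 (j + 1), (κ (j + 1) - κ a) * w a =
      ∑ a ∈ Finset.Ico 1 j, (κ j - κ a) * w a
        + (κ (j + 1) - κ j) * ∑ a ∈ Finset.Ico 1 (j + 1), w a := by
  rw [Finset.sum_Ico_succ_top hj, Finset.sum_Ico_succ_top hj, mul_add, Finset.mul_sum, ← add_assoc,
    ← Finset.sum_add_distrib]
  congr 1
  exact Finset.sum_congr rfl fun a _ => by ring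

theorem sum_Ioc_sub_mul {M j : ℕ} (hj : j < M) (κ w : ℕ → ℝ) :
    ∑ a ∈ Finset.Ioc j M, (κ a - κ j) * w a =
      ∑ a ∈ Finset.Ioc (j + 1) M, (κ a - κ (j + 1)) * w a
        + (κ (j + 1) - κ j) * ∑ a ∈ Finset.Ioc j M, w a := by
  rw [← Finset.Ico_add_one_add_one_eq_Ioc, ← Finset.Ico_add_one_add_one_eq_Ioc,
    Finset.sum_eq_sum_Ico_succ_bot (by omega : j + 1 < M + 1),
    Finset.sum_eq_sum_Ico_succ_bot (by omega : j + 1 < M + 1), mul_add, Finset.mul_sum,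
    add_left_comm, ← Finset.sum_add_distrib]
  congr 1
  exact Finset.sum_congr rfl fun a _ => by ring

/-- A measure `m` is the second difference of `g` on the grid `κ` iff its left potential is `g`
and its total mass vanishes. -/
theorem second_difference_iff {M : ℕ} (hM : 1 ≤ M) {κ m g up dn : ℕ → ℝ}
    (hκ : ∀ j, 1 ≤ j → j < M → κ j < κ (j + 1))
    (hup : ∀ j, 1 ≤ j → j < M → (κ (j + 1) - κ j) * up j = g j)
    (hdn : ∀ j, 1 ≤ j → j < M → (κ (j + 1) - κ j) * dn (j + 1) = g (j + 1))
    (hup0 : up 0 = 0) (hdn1 : dn 1 = 0) (hupM : up M = 0) (hdnM : dn (M + 1) = 0)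
    (hg1 : g 1 = 0) :
    (∀ j, 1 ≤ j → j ≤ M → m j = (dn (j + 1) - up j) - (dn j - up (j - 1))) ↔
      (∀ j, 1 ≤ j → j ≤ M → ∑ a ∈ Finset.Ico 1 j, (κ j - κ a) * m a = g j) ∧
        ∑ a ∈ Finset.Icc 1 M, m a = 0 := by
  have hIcc : Finset.Icc 1 M = Finset.Ico 1 (M + 1) :=
    (Finset.Ico_add_one_right_eq_Icc 1 M).symm
  constructor
  · intro h
    have hS : ∀ j, 1 ≤ j → j ≤ M + 1 → ∑ a ∈ Finset.Ico 1 j, m a = dn j - up (j - 1) := by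
      intro j hj
      induction j, hj using Nat.le_induction with
      | base => simp [hup0, hdn1]
      | succ j hj ih =>
        intro hjM
        rw [Finset.sum_Ico_succ_top hj, ih (by omega), h j hj (by omega)]
        simp
    refine ⟨?_, by rw [hIcc, hS _ (by omega) le_rfl]; simp [hdnM, hupM]⟩
    intro j hj
    induction j, hj using Nat.le_induction with
    | base => simp [hg1]
    | succ j hj ih =>
      intro hjM
      rw [sum_Ico_succ_sub_mul hj, ih (by omega), hS _ (by omega) (by omega),
        Nat.add_sub_cancel, mul_sub, hup j hj hjM, hdn j hj hjM]
      ring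
  · rintro ⟨hT, h0⟩
    have hS : ∀ j, 1 ≤ j → j ≤ M → ∑ a ∈ Finset.Ico 1 (j + 1), m a = dn (j + 1) - up j := by
      intro j hj hjM
      rcases hjM.lt_or_eq with hlt | rfl
      · have h := sum_Ico_succ_sub_mul hj κ m
        rw [hT _ (by omega) (by omega), hT _ hj hjM, ← hup j hj hlt, ← hdn j hj hlt] at h
        have hpos : κ (j + 1) - κ j ≠ 0 := (sub_pos.2 (hκ j hj hlt)).ne'
        apply mul_left_cancel₀ hpos
        linarith
      · rw [← hIcc, h0, hupM, hdnM, sub_zero]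
    intro j hj hjM
    have h := hS j hj hjM
    rw [Finset.sum_Ico_succ_top hj] at h
    rcases hj.lt_or_eq with hlt | rfl
    · have h' := hS (j - 1) (by omega) (by omega)
      rw [Nat.sub_add_cancel hj] at h'
      linarith
    · simp at h
      simp [hdn1, hup0, h]

/-- The system characterizing an embedding with initial law on `{κ_{l-1}, κ_l}`. -/
theorem embedding_iff {M l : ℕ} (hM : 1 ≤ M) (hl : 2 ≤ l) (hlM : l ≤ M)
    {κ w g up dn : ℕ → ℝ} {α β : ℝ} (hα : 0 < α)
    (hκ : ∀ j, 1 ≤ j → j < M → κ j < κ (j + 1))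
    (hup : ∀ j, 1 ≤ j → j < M → (κ (j + 1) - κ j) * up j = g j)
    (hdn : ∀ j, 1 ≤ j → j < M → (κ (j + 1) - κ j) * dn (j + 1) = g (j + 1))
    (hup0 : up 0 = 0) (hdn1 : dn 1 = 0) (hupM : up M = 0) (hdnM : dn (M + 1) = 0)
    (hg1 : g 1 = 0) (hgM : g M = 0) :
    (∀ j, 1 ≤ j → j ≤ M → α * (w j + (up j + dn j) - up (j - 1) - dn (j + 1)) =
        (if j = l - 1 then 1 - β else 0) + (if j = l then β else 0)) ↔
      α * ∑ a ∈ Finset.Icc 1 M, w a = 1 ∧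
      α * ∑ a ∈ Finset.Icc 1 M, κ a * w a = (1 - β) * κ (l - 1) + β * κ l ∧
      (∀ j, 1 ≤ j → j ≤ l - 1 → g j = ∑ a ∈ Finset.Ico 1 j, (κ j - κ a) * w a) ∧
      (∀ j, l ≤ j → j ≤ M → g j = ∑ a ∈ Finset.Ioc j M, (κ a - κ j) * w a) := by
  set r : ℕ → ℝ := fun j => (if j = l - 1 then 1 - β else 0) + (if j = l then β else 0) with hr
  set m : ℕ → ℝ := fun j => w j - r j / α with hm
  have hmem : l - 1 ∈ Finset.Icc 1 M ∧ l ∈ Finset.Icc 1 M := by simp; omega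
  have hsum (f : ℕ → ℝ) : α * ∑ a ∈ Finset.Icc 1 M, f a * m a
      = α * ∑ a ∈ Finset.Icc 1 M, f a * w a - ((1 - β) * f (l - 1) + β * f l) := by
    have : ∑ a ∈ Finset.Icc 1 M, f a * r a = (1 - β) * f (l - 1) + β * f l := by
      simp only [hr, mul_add, Finset.sum_add_distrib, mul_ite, mul_zero, Finset.sum_ite_eq',
        hmem, if_true]
      ring
    rw [← this, Finset.mul_sum, Finset.mul_sum, ← Finset.sum_sub_distrib]
    refine Finset.sum_congr rfl fun a _ => ?_
    simp only [hm]
    field_simp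
  have h0 := hsum fun _ => 1
  simp only [one_mul, mul_one, sub_add_cancel] at h0
  have hκm := hsum κ
  have hleft (j : ℕ) (hj : j ≤ l - 1) : ∑ a ∈ Finset.Ico 1 j, (κ j - κ a) * m a
      = ∑ a ∈ Finset.Ico 1 j, (κ j - κ a) * w a := by
    refine Finset.sum_congr rfl fun a ha => ?_
    rw [Finset.mem_Ico] at ha
    simp only [hm, hr]
    rw [if_neg (by omega), if_neg (by omega)]
    simp
  have hright (j : ℕ) (hj : l ≤ j) : ∑ a ∈ Finset.Ioc j M, (κ a - κ j) * m a
      = ∑ a ∈ Finset.Ioc j M, (κ a - κ j) * w a := by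
    refine Finset.sum_congr rfl fun a ha => ?_
    rw [Finset.mem_Ioc] at ha
    simp only [hm, hr]
    rw [if_neg (by omega), if_neg (by omega)]
    simp
  have hcenter (c : ℝ) : ∑ a ∈ Finset.Icc 1 M, (κ a - c) * m a
      = ∑ a ∈ Finset.Icc 1 M, κ a * m a - c * ∑ a ∈ Finset.Icc 1 M, m a := by
    rw [Finset.mul_sum, ← Finset.sum_sub_distrib]
    exact Finset.sum_congr rfl fun a _ => by ring
  have key := second_difference_iff (m := m) hM hκ hup hdn hup0 hdn1 hupM hdnM hg1
  have hE : (∀ j, 1 ≤ j → j ≤ M → α * (w j + (up j + dn j) - up (j - 1) - dn (j + 1)) = r j) ↔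
      ∀ j, 1 ≤ j → j ≤ M → m j = (dn (j + 1) - up j) - (dn j - up (j - 1)) := by
    refine forall_congr' fun j => forall_congr' fun _ => forall_congr' fun _ => ?_
    rw [show m j = w j - r j / α from rfl]
    generalize r j = x
    constructor
    · rintro rfl
      field_simp
      ring
    · intro h
      rw [sub_eq_iff_eq_add, ← sub_eq_iff_eq_add', eq_div_iff hα.ne'] at h
      rw [← h]
      ring
  refine hE.trans (key.trans ?_)
  constructor
  · rintro ⟨hT, hz⟩
    have hK : ∑ a ∈ Finset.Icc 1 M, κ a * m a = 0 := by
      have h1 := hcenter (κ M)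
      rw [sum_Icc_sub_mul_eq hM le_rfl, hT M hM le_rfl, hgM, hz] at h1
      simpa using h1.symm
    refine ⟨by rw [hz] at h0; linarith, by rw [hK] at hκm; linarith, fun j h1 h2 => ?_,
      fun j h1 h2 => ?_⟩
    · rw [← hleft j h2, hT j h1 (by omega)]
    · have h := sum_Icc_sub_mul_eq (by omega : 1 ≤ j) h2 κ m
      rw [hcenter, hK, hz, hT j (by omega) h2] at h
      rw [← hright j h1]
      linarith
  · rintro ⟨hW, hK, hL, hR⟩
    have hz : ∑ a ∈ Finset.Icc 1 M, m a = 0 := by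
      rw [hW, sub_self] at h0
      exact (mul_eq_zero.1 h0).resolve_left hα.ne'
    have hz' : ∑ a ∈ Finset.Icc 1 M, κ a * m a = 0 := by
      rw [hK, sub_self] at hκm
      exact (mul_eq_zero.1 hκm).resolve_left hα.ne'
    refine ⟨fun j h1 h2 => ?_, hz⟩
    rcases le_or_gt j (l - 1) with h | h
    · rw [hleft j h, hL j h1 h]
    · have h3 := sum_Icc_sub_mul_eq h1 h2 κ m
      rw [hcenter, hz, hz', hright j (by omega), ← hR j (by omega) h2] at h3
      linarith

/-- Left potential with feedback `ρ`. -/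
def leftPot (κ p ρ : ℕ → ℝ) (j : ℕ) : ℝ :=
  ∑ a ∈ (Finset.Ico 1 j).attach, (κ j - κ a) * (p a + leftPot κ p ρ a * ρ a)
termination_by j
decreasing_by exact (Finset.mem_Ico.1 a.2).2

/-- Right potential with feedback `ρ`. -/
def rightPot (M : ℕ) (κ p ρ : ℕ → ℝ) (j : ℕ) : ℝ :=
  ∑ a ∈ (Finset.Ioc j M).attach, (κ a - κ j) * (p a + rightPot M κ p ρ a * ρ a)
termination_by M - j
decreasing_by
  have := Finset.mem_Ioc.1 a.2
  omega

theorem leftPot_eq (κ p ρ : ℕ → ℝ) (j : ℕ) : leftPot κ p ρ j =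
    ∑ a ∈ Finset.Ico 1 j, (κ j - κ a) * (p a + leftPot κ p ρ a * ρ a) := by
  rw [leftPot]
  exact Finset.sum_attach _ fun a => (κ j - κ a) * (p a + leftPot κ p ρ a * ρ a)

theorem rightPot_eq (M : ℕ) (κ p ρ : ℕ → ℝ) (j : ℕ) : rightPot M κ p ρ j =
    ∑ a ∈ Finset.Ioc j M, (κ a - κ j) * (p a + rightPot M κ p ρ a * ρ a) := by
  rw [rightPot]
  exact Finset.sum_attach _ fun a => (κ a - κ j) * (p a + rightPot M κ p ρ a * ρ a)

theorem lt_of_succ_lt {M : ℕ} {κ : ℕ → ℝ} (hκ : ∀ j, 1 ≤ j → j < M → κ j < κ (j + 1))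
    {a j : ℕ} (ha : 1 ≤ a) (haj : a < j) (hj : j ≤ M) : κ a < κ j := by
  induction j, haj using Nat.le_induction with
  | base => exact hκ a ha hj
  | succ j hj' ih => exact (ih (by omega)).trans (hκ j (by omega) hj)

theorem leftPot_nonneg {M : ℕ} {κ p ρ : ℕ → ℝ} (hκ : ∀ j, 1 ≤ j → j < M → κ j < κ (j + 1))
    (hp : ∀ j, 1 ≤ j → j ≤ M → 0 < p j) (hρ : ∀ j, 1 ≤ j → j ≤ M → 0 ≤ ρ j)
    (j : ℕ) (hj : j ≤ M) : 0 ≤ leftPot κ p ρ j := by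
  induction j using Nat.strong_induction_on with
  | _ j ih =>
    rw [leftPot_eq]
    refine Finset.sum_nonneg fun a ha => ?_
    rw [Finset.mem_Ico] at ha
    have h1 := lt_of_succ_lt hκ ha.1 ha.2 hj
    have h2 := hp a ha.1 (by omega)
    have h3 := mul_nonneg (ih a ha.2 (by omega)) (hρ a ha.1 (by omega))
    exact mul_nonneg (by linarith) (by linarith)

theorem rightPot_nonneg {M : ℕ} {κ p ρ : ℕ → ℝ} (hκ : ∀ j, 1 ≤ j → j < M → κ j < κ (j + 1))
    (hp : ∀ j, 1 ≤ j → j ≤ M → 0 < p j) (hρ : ∀ j, 1 ≤ j → j ≤ M → 0 ≤ ρ j)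
    (j : ℕ) (hj : 1 ≤ j) : 0 ≤ rightPot M κ p ρ j := by
  induction hn : M - j using Nat.strong_induction_on generalizing j with
  | _ n ih =>
    rw [rightPot_eq]
    refine Finset.sum_nonneg fun a ha => ?_
    rw [Finset.mem_Ioc] at ha
    have h1 := lt_of_succ_lt hκ hj ha.1 ha.2
    have h2 := hp a (by omega) ha.2
    have h3 := mul_nonneg (ih (M - a) (by omega) a (by omega) rfl) (hρ a (by omega) ha.2)
    exact mul_nonneg (by linarith) (by linarith)

theorem leftPot_lt_succ {M : ℕ} {κ p ρ : ℕ → ℝ} (hκ : ∀ j, 1 ≤ j → j < M → κ j < κ (j + 1))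
    (hp : ∀ j, 1 ≤ j → j ≤ M → 0 < p j) (hρ : ∀ j, 1 ≤ j → j ≤ M → 0 ≤ ρ j)
    (j : ℕ) (hj : 1 ≤ j) (hjM : j < M) : leftPot κ p ρ j < leftPot κ p ρ (j + 1) := by
  rw [leftPot_eq _ _ _ (j + 1), sum_Ico_succ_sub_mul hj, ← leftPot_eq]
  refine lt_add_of_pos_right _ (mul_pos (sub_pos.2 (hκ j hj hjM))
    (Finset.sum_pos ?_ ⟨j, by simp [hj]⟩))
  intro a ha
  rw [Finset.mem_Ico] at ha
  have h3 := mul_nonneg (leftPot_nonneg hκ hp hρ a (by omega)) (hρ a ha.1 (by omega))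
  linarith [hp a ha.1 (by omega)]

theorem rightPot_succ_lt {M : ℕ} {κ p ρ : ℕ → ℝ} (hκ : ∀ j, 1 ≤ j → j < M → κ j < κ (j + 1))
    (hp : ∀ j, 1 ≤ j → j ≤ M → 0 < p j) (hρ : ∀ j, 1 ≤ j → j ≤ M → 0 ≤ ρ j)
    (j : ℕ) (hj : 1 ≤ j) (hjM : j < M) : rightPot M κ p ρ (j + 1) < rightPot M κ p ρ j := by
  rw [rightPot_eq _ _ _ _ j, sum_Ioc_sub_mul hjM, ← rightPot_eq]
  refine lt_add_of_pos_right _ (mul_pos (sub_pos.2 (hκ j hj hjM))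
    (Finset.sum_pos ?_ ⟨j + 1, by simp; omega⟩))
  intro a ha
  rw [Finset.mem_Ioc] at ha
  have h3 := mul_nonneg (rightPot_nonneg hκ hp hρ a (by omega)) (hρ a (by omega) ha.2)
  linarith [hp a (by omega) ha.2]

/-- `g` is the left potential below `l`, the right potential from `l` on, and the barycentre of
the measure `p + g ρ` lies in `(κ_{l-1}, κ_l]`. -/
def IsPotential (M : ℕ) (κ p ρ g : ℕ → ℝ) (l : ℕ) : Prop :=
  2 ≤ l ∧ l ≤ M ∧
  (∀ j, 1 ≤ j → j ≤ l - 1 → g j = ∑ a ∈ Finset.Ico 1 j, (κ j - κ a) * (p a + g a * ρ a)) ∧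
  (∀ j, l ≤ j → j ≤ M → g j = ∑ a ∈ Finset.Ioc j M, (κ a - κ j) * (p a + g a * ρ a)) ∧
  0 < ∑ a ∈ Finset.Icc 1 M, (κ a - κ (l - 1)) * (p a + g a * ρ a) ∧
  ∑ a ∈ Finset.Icc 1 M, (κ a - κ l) * (p a + g a * ρ a) ≤ 0

theorem sum_left_eq_leftPot {κ p ρ g : ℕ → ℝ} {l : ℕ}
    (hg : ∀ j, 1 ≤ j → j ≤ l - 1 → g j = leftPot κ p ρ j) (j : ℕ) (hj : j ≤ l) :
    ∑ a ∈ Finset.Ico 1 j, (κ j - κ a) * (p a + g a * ρ a) = leftPot κ p ρ j := by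
  rw [leftPot_eq]
  refine Finset.sum_congr rfl fun a ha => ?_
  rw [Finset.mem_Ico] at ha
  rw [hg a ha.1 (by omega)]

theorem sum_right_eq_rightPot {M : ℕ} {κ p ρ g : ℕ → ℝ} {l : ℕ}
    (hg : ∀ j, l ≤ j → j ≤ M → g j = rightPot M κ p ρ j) (j : ℕ) (hj : l - 1 ≤ j) :
    ∑ a ∈ Finset.Ioc j M, (κ a - κ j) * (p a + g a * ρ a) = rightPot M κ p ρ j := by
  rw [rightPot_eq]
  refine Finset.sum_congr rfl fun a ha => ?_
  rw [Finset.mem_Ioc] at ha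
  rw [hg a (by omega) ha.2]

theorem isPotential_iff {M : ℕ} {κ p ρ g : ℕ → ℝ} {l : ℕ} :
    IsPotential M κ p ρ g l ↔ 2 ≤ l ∧ l ≤ M ∧
      (∀ j, 1 ≤ j → j ≤ l - 1 → g j = leftPot κ p ρ j) ∧
      (∀ j, l ≤ j → j ≤ M → g j = rightPot M κ p ρ j) ∧
      leftPot κ p ρ (l - 1) < rightPot M κ p ρ (l - 1) ∧
      rightPot M κ p ρ l ≤ leftPot κ p ρ l := by
  unfold IsPotential
  refine and_congr_right fun hl => and_congr_right fun hlM => ?_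
  have hL : (∀ j, 1 ≤ j → j ≤ l - 1 →
      g j = ∑ a ∈ Finset.Ico 1 j, (κ j - κ a) * (p a + g a * ρ a)) ↔
      ∀ j, 1 ≤ j → j ≤ l - 1 → g j = leftPot κ p ρ j := by
    constructor
    · intro h j
      induction j using Nat.strong_induction_on with
      | _ j ih =>
        intro h1 h2
        rw [h j h1 h2, leftPot_eq]
        refine Finset.sum_congr rfl fun a ha => ?_
        rw [Finset.mem_Ico] at ha
        rw [ih a ha.2 ha.1 (by omega)]
    · intro h j h1 h2
      rw [sum_left_eq_leftPot h j (by omega), h j h1 h2]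
  have hR : (∀ j, l ≤ j → j ≤ M →
      g j = ∑ a ∈ Finset.Ioc j M, (κ a - κ j) * (p a + g a * ρ a)) ↔
      ∀ j, l ≤ j → j ≤ M → g j = rightPot M κ p ρ j := by
    constructor
    · intro h j
      induction hn : M - j using Nat.strong_induction_on generalizing j with
      | _ n ih =>
        intro h1 h2
        rw [h j h1 h2, rightPot_eq]
        refine Finset.sum_congr rfl fun a ha => ?_
        rw [Finset.mem_Ioc] at ha
        rw [ih (M - a) (by omega) a rfl (by omega) ha.2]
    · intro h j h1 h2
      rw [sum_right_eq_rightPot h j (by omega), h j h1 h2]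
  rw [hL, hR]
  refine and_congr_right fun h1 => and_congr_right fun h2 => ?_
  rw [sum_Icc_sub_mul_eq (by omega) (by omega), sum_Icc_sub_mul_eq (by omega) hlM,
    sum_left_eq_leftPot h1 _ (by omega), sum_right_eq_rightPot h2 _ (by omega),
    sum_left_eq_leftPot h1 _ (by omega), sum_right_eq_rightPot h2 _ (by omega), sub_pos,
    sub_nonpos]

theorem IsPotential.unique {M : ℕ} {κ p ρ g g' : ℕ → ℝ} {l l' : ℕ}
    (hκ : ∀ j, 1 ≤ j → j < M → κ j < κ (j + 1))
    (hp : ∀ j, 1 ≤ j → j ≤ M → 0 < p j) (hρ : ∀ j, 1 ≤ j → j ≤ M → 0 ≤ ρ j)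
    (h : IsPotential M κ p ρ g l) (h' : IsPotential M κ p ρ g' l') :
    l = l' ∧ ∀ j, 1 ≤ j → j ≤ M → g j = g' j := by
  rw [isPotential_iff] at h h'
  have aux : ∀ {l l' : ℕ}, 2 ≤ l → l' ≤ M →
      leftPot κ p ρ (l' - 1) < rightPot M κ p ρ (l' - 1) →
      rightPot M κ p ρ l ≤ leftPot κ p ρ l → l' ≤ l := by
    intro l l' hl hl' h1 h2
    by_contra! hlt
    have h3 : ∀ j, l ≤ j → j ≤ M → rightPot M κ p ρ j ≤ leftPot κ p ρ j := by
      intro j hj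
      induction j, hj using Nat.le_induction with
      | base => exact fun _ => h2
      | succ j hj ih =>
        intro hjM
        have := ih (by omega)
        have := rightPot_succ_lt hκ hp hρ j (by omega) hjM
        have := leftPot_lt_succ hκ hp hρ j (by omega) hjM
        linarith
    exact absurd h1 (h3 (l' - 1) (by omega) (by omega)).not_gt
  obtain ⟨h1, h2, h3, h4, h5, h6⟩ := h
  obtain ⟨h1', h2', h3', h4', h5', h6'⟩ := h'
  obtain rfl : l = l' := le_antisymm (aux h1' h2 h5 h6') (aux h1 h2' h5' h6)
  refine ⟨rfl, fun j hj hjM => ?_⟩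
  rcases le_or_gt j (l - 1) with h | h
  · rw [h3 j hj h, h3' j hj h]
  · rw [h4 j (by omega) hjM, h4' j (by omega) hjM]

theorem exists_isPotential {M : ℕ} (hM : 2 ≤ M) {κ p ρ : ℕ → ℝ}
    (hκ : ∀ j, 1 ≤ j → j < M → κ j < κ (j + 1))
    (hp : ∀ j, 1 ≤ j → j ≤ M → 0 < p j) (hρ : ∀ j, 1 ≤ j → j ≤ M → 0 ≤ ρ j) :
    ∃ g l, IsPotential M κ p ρ g l ∧ (∀ j, 1 ≤ j → j ≤ M → 0 ≤ g j) ∧ g 1 = 0 ∧ g M = 0 := by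
  have hF1 : leftPot κ p ρ 1 = 0 := by rw [leftPot_eq]; simp
  have hBM : rightPot M κ p ρ M = 0 := by rw [rightPot_eq]; simp
  have hB1 : 0 < rightPot M κ p ρ 1 :=
    (rightPot_nonneg hκ hp hρ 2 (by omega)).trans_lt
      (rightPot_succ_lt hκ hp hρ 1 le_rfl (by omega))
  have hex : ∃ l, 1 ≤ l ∧ rightPot M κ p ρ l ≤ leftPot κ p ρ l :=
    ⟨M, by omega, by rw [hBM]; exact leftPot_nonneg hκ hp hρ M le_rfl⟩
  classical
  set l := Nat.find hex with hl
  have hspec := Nat.find_spec hex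
  rw [← hl] at hspec
  have hlM : l ≤ M := Nat.find_min' hex ⟨by omega, by
    rw [hBM]; exact leftPot_nonneg hκ hp hρ M le_rfl⟩
  have hl2 : 2 ≤ l := by
    by_contra! hlt
    have : l = 1 := by omega
    rw [this, hF1] at hspec
    exact absurd hB1 hspec.2.not_gt
  have hmin : leftPot κ p ρ (l - 1) < rightPot M κ p ρ (l - 1) := by
    have := Nat.find_min hex (m := l - 1) (by omega)
    by_contra! h
    exact this ⟨by omega, h⟩
  refine ⟨fun j => if j ≤ l - 1 then leftPot κ p ρ j else rightPot M κ p ρ j, l,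
    isPotential_iff.2 ⟨hl2, hlM, fun j _ h => if_pos h, fun j h _ => if_neg (by omega), hmin,
      hspec.2⟩, fun j h1 h2 => ?_, ?_, ?_⟩
  · dsimp only
    split_ifs
    · exact leftPot_nonneg hκ hp hρ j h2
    · exact rightPot_nonneg hκ hp hρ j h1
  · dsimp only
    rw [if_pos (by omega), hF1]
  · dsimp only
    rw [if_neg (by omega), hBM]

/-! ### The stopped chain -/

theorem sum_fin_succ_eq (n : ℕ) (f : ℕ → ℝ) :
    ∑ v : Fin n, f (v.1 + 1) = ∑ c ∈ Finset.Icc 1 n, f c := by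
  rw [Fin.sum_univ_eq_sum_range (fun v => f (v + 1)) n, Finset.range_eq_Ico,
    Finset.sum_Ico_add' f 0 n 1, zero_add, Finset.Ico_add_one_right_eq_Icc]

theorem fid_val_succ {M j : ℕ} (hj : 1 ≤ j) (hjM : j ≤ M + 1) : (fid M j).1 + 1 = j := by
  simp only [fid]
  rw [Nat.mod_eq_of_lt (by omega)]
  omega

theorem fid_eq_iff {M j l : ℕ} (hj : 1 ≤ j) (hjM : j ≤ M + 1) (hl : 1 ≤ l) (hlM : l ≤ M + 1) :
    fid M j = fid M l ↔ j = l := by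
  have h1 := fid_val_succ hj hjM
  have h2 := fid_val_succ hl hlM
  rw [Fin.ext_iff]
  omega

theorem NtE_eq {M : ℕ} {t : ℝ} {i b k lam : ℕ → ℝ} (hlam : IntensityVec M lam) (j c : ℕ) :
    NtE M t i b k lam j c = (if c = j then 1 + t * lam j * (1 + ktil M i k j) else 0)
      - (if c = j + 1 then t * lam j * qup i b j else 0)
      - (if c = j - 1 then t * lam j * qdn i b j else 0)
      - (if c = M + 1 then t * lam j * ktil M i k j else 0) := by
  unfold NtE
  by_cases hj : 2 ≤ j ∧ j ≤ M - 1
  · rw [if_pos hj]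
    by_cases h1 : c = j
    · rw [if_pos h1, if_pos h1, if_neg (by omega), if_neg (by omega), if_neg (by omega)]
      ring
    by_cases h2 : c = j + 1
    · rw [if_neg h1, if_pos h2, if_neg h1, if_pos h2, if_neg (by omega), if_neg (by omega)]
      ring
    by_cases h3 : c = j - 1
    · rw [if_neg h1, if_neg h2, if_pos h3, if_neg h1, if_neg h2, if_pos h3, if_neg (by omega)]
      ring
    · rw [if_neg h1, if_neg h2, if_neg h3, if_neg h1, if_neg h2, if_neg h3]
      split_ifs <;> ring
  · rw [if_neg hj, hlam.2 j hj]
    simp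

theorem one_sub_smul_Ptilde {M : ℕ} {t h : ℝ} (ht : 0 < t) (hh : 0 < h) (i b k lam : ℕ → ℝ) :
    1 - (t / (t + h)) • Ptilde M h i b k lam
      = (1 - t / (t + h)) • Ntilde M t i b k lam := by
  have hth : t + h ≠ 0 := by positivity
  ext u v
  have huv : u = v ↔ v.1 + 1 = u.1 + 1 := by rw [Fin.ext_iff]; omega
  simp only [Matrix.sub_apply, Matrix.smul_apply, Matrix.one_apply, Ptilde, Ntilde,
    Matrix.of_apply, huv, PtE, NtE, smul_eq_mul]
  split_ifs <;> field_simp <;> ring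

theorem isUnit_det_Ntilde {M : ℕ} {t : ℝ} (ht : 0 < t) {i b k lam : ℕ → ℝ}
    (hlam : IntensityVec M lam) (hkt : ∀ j, 0 ≤ ktil M i k j)
    (hq : ∀ j, 2 ≤ j → j ≤ M - 1 → 0 ≤ qup i b j ∧ 0 ≤ qdn i b j ∧ qup i b j + qdn i b j = 1) :
    IsUnit (Ntilde M t i b k lam).det := by
  refine isUnit_iff_ne_zero.2 (det_ne_zero_of_sum_row_lt_diag fun u => ?_)
  set j := u.1 + 1 with hj
  have hx : 0 ≤ t * lam j * qup i b j ∧ 0 ≤ t * lam j * qdn i b j ∧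
      0 ≤ t * lam j * ktil M i k j ∧
      t * lam j * qup i b j + t * lam j * qdn i b j = t * lam j := by
    by_cases h : 2 ≤ j ∧ j ≤ M - 1
    · obtain ⟨h1, h2, h3⟩ := hq j h.1 h.2
      have h4 := mul_nonneg ht.le (hlam.1 j h.1 h.2)
      exact ⟨mul_nonneg h4 h1, mul_nonneg h4 h2, mul_nonneg h4 (hkt j), by
        rw [← mul_add, h3, mul_one]⟩
    · simp [hlam.2 j h]
  obtain ⟨hx, hy, hz, hxy⟩ := hx
  set x := t * lam j * qup i b j
  set y := t * lam j * qdn i b j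
  set z := t * lam j * ktil M i k j with hzdef
  have hdiag : ‖Ntilde M t i b k lam u u‖ = 1 + (x + y + z) := by
    have : Ntilde M t i b k lam u u = 1 + (x + y + z) := by
      simp only [Ntilde, Matrix.of_apply, ← hj]
      by_cases h : 2 ≤ j ∧ j ≤ M - 1
      · simp only [NtE, if_pos h, if_true]
        rw [hxy, hzdef]
        ring
      · rw [hxy, hzdef]
        simp [NtE, h, hlam.2 j h]
    rw [this, Real.norm_of_nonneg (by linarith)]
  have hle (c : ℕ) (a : ℝ) (ha : 0 ≤ a) :
      ∑ v : Fin (M + 1), (if v.1 + 1 = c then a else 0) ≤ a := by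
    rw [sum_fin_succ_eq (M + 1) fun v => if v = c then a else 0, Finset.sum_ite_eq']
    split_ifs <;> simp [ha]
  calc ∑ v ∈ Finset.univ.erase u, ‖Ntilde M t i b k lam u v‖
      ≤ ∑ v ∈ Finset.univ.erase u, ((if v.1 + 1 = j + 1 then x else 0)
          + (if v.1 + 1 = j - 1 then y else 0) + (if v.1 + 1 = M + 1 then z else 0)) := by
        refine Finset.sum_le_sum fun v hv => ?_
        have hne : ¬ v.1 + 1 = j := by
          have := Finset.ne_of_mem_erase hv
          rw [Ne, Fin.ext_iff] at this
          omega
        simp only [Ntilde, Matrix.of_apply, ← hj]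
        rw [NtE_eq hlam, if_neg hne, Real.norm_eq_abs, abs_le]
        constructor <;> split_ifs <;> linarith
    _ ≤ ∑ v : Fin (M + 1), ((if v.1 + 1 = j + 1 then x else 0)
          + (if v.1 + 1 = j - 1 then y else 0) + (if v.1 + 1 = M + 1 then z else 0)) := by
        refine Finset.sum_le_sum_of_subset_of_nonneg (Finset.subset_univ _) fun v _ _ => ?_
        split_ifs <;> linarith
    _ ≤ x + y + z := by
        rw [Finset.sum_add_distrib, Finset.sum_add_distrib]
        exact add_le_add (add_le_add (hle _ x hx) (hle _ y hy)) (hle _ z hz)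
    _ < ‖Ntilde M t i b k lam u u‖ := by rw [hdiag]; linarith

theorem vecMul_Ntilde {M : ℕ} {t α : ℝ} {i b k lam p : ℕ → ℝ} (hlam : IntensityVec M lam)
    (hq : ∀ j, 2 ≤ j → j ≤ M - 1 → qup i b j + qdn i b j = 1)
    {y : Fin (M + 1) → ℝ} (hy : ∀ u : Fin M, y u.castSucc = α * p (u.1 + 1))
    (j : ℕ) (hj : 1 ≤ j) (hjM : j ≤ M) :
    Matrix.vecMul y (Ntilde M t i b k lam) (fid M j) =
      α * (p j * (1 + t * lam j * ktil M i k j)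
        + (t * lam j * p j * qup i b j + t * lam j * p j * qdn i b j)
        - t * lam (j - 1) * p (j - 1) * qup i b (j - 1)
        - t * lam (j + 1) * p (j + 1) * qdn i b (j + 1)) := by
  have hs : lam j * (qup i b j + qdn i b j) = lam j := by
    by_cases hint : 2 ≤ j ∧ j ≤ M - 1
    · rw [hq j hint.1 hint.2, mul_one]
    · rw [hlam.2 j hint, zero_mul]
  have hlast : NtE M t i b k lam (M + 1) j = 0 := by
    unfold NtE
    rw [if_neg (by omega), if_neg (by omega)]
  simp only [Matrix.vecMul, dotProduct, Fin.sum_univ_castSucc, Ntilde, Matrix.of_apply,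
    Fin.val_castSucc, Fin.val_last, fid_val_succ hj (by omega : j ≤ M + 1), hlast, hy, mul_zero,
    add_zero]
  rw [sum_fin_succ_eq M fun a => α * p a * NtE M t i b k lam a j]
  have h1 (a : ℕ) (ha : a ∈ Finset.Icc 1 M) : α * p a * NtE M t i b k lam a j =
      (if j = a then α * p a * (1 + t * lam a * (1 + ktil M i k a)) else 0)
      - (if j - 1 = a then α * p a * (t * lam a * qup i b a) else 0)
      - (if j + 1 = a then α * p a * (t * lam a * qdn i b a) else 0) := by
    rw [Finset.mem_Icc] at ha
    rw [NtE_eq hlam, if_neg (by omega : ¬ j = M + 1)]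
    simp only [show (j = a + 1) = (j - 1 = a) by apply propext; omega,
      show (j = a - 1) = (j + 1 = a) by apply propext; omega]
    split_ifs <;> ring
  rw [Finset.sum_congr rfl h1]
  simp only [Finset.sum_sub_distrib, Finset.sum_ite_eq]
  rw [if_pos (by simp; omega)]
  have h2 : (if j - 1 ∈ Finset.Icc 1 M then
      α * p (j - 1) * (t * lam (j - 1) * qup i b (j - 1)) else 0)
      = α * p (j - 1) * (t * lam (j - 1) * qup i b (j - 1)) := by
    split_ifs with h
    · rfl
    · rw [Finset.mem_Icc] at h
      rw [hlam.2 (j - 1) (by omega)]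
      ring
  have h3 : (if j + 1 ∈ Finset.Icc 1 M then
      α * p (j + 1) * (t * lam (j + 1) * qdn i b (j + 1)) else 0)
      = α * p (j + 1) * (t * lam (j + 1) * qdn i b (j + 1)) := by
    split_ifs with h
    · rfl
    · rw [Finset.mem_Icc] at h
      rw [hlam.2 (j + 1) (by omega)]
      ring
  rw [h2, h3]
  linear_combination (-α * p j * t) * hs

/-- The law of the geometrically stopped chain does not depend on the step length, and equals
`α p` on the grid iff `α p` solves the adjoint equation. -/
theorem stopped_law_iff {M l : ℕ} (hl : 2 ≤ l) (hlM : l ≤ M) {t h α β : ℝ} (ht : 0 < t)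
    (hh : 0 < h) {i b k lam p : ℕ → ℝ} (hlam : IntensityVec M lam)
    (hkt : ∀ j, 0 ≤ ktil M i k j)
    (hq : ∀ j, 2 ≤ j → j ≤ M - 1 → 0 ≤ qup i b j ∧ 0 ≤ qdn i b j ∧ qup i b j + qdn i b j = 1) :
    (IsUnit (1 - (t / (t + h)) • Ptilde M h i b k lam) ∧
    ∀ j, 1 ≤ j → j ≤ M →
      (1 - t / (t + h)) *
          ((1 - β) *
              (1 - (t / (t + h)) • Ptilde M h i b k lam)⁻¹ (fid M (l - 1)) (fid M j)
            + β * (1 - (t / (t + h)) • Ptilde M h i b k lam)⁻¹ (fid M l) (fid M j))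
        = α * p j) ↔
    ∀ j, 1 ≤ j → j ≤ M →
      α * (p j * (1 + t * lam j * ktil M i k j)
        + (t * lam j * p j * qup i b j + t * lam j * p j * qdn i b j)
        - t * lam (j - 1) * p (j - 1) * qup i b (j - 1)
        - t * lam (j + 1) * p (j + 1) * qdn i b (j + 1)) =
      (if j = l - 1 then 1 - β else 0) + (if j = l then β else 0) := by
  rw [one_sub_smul_Ptilde ht hh]
  have hdet := isUnit_det_Ntilde ht hlam hkt hq
  set N := Ntilde M t i b k lam with hN
  have hc : 1 - t / (t + h) ≠ 0 := by
    have : 1 - t / (t + h) = h / (t + h) := by field_simp; ring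
    rw [this]
    positivity
  set c := 1 - t / (t + h)
  have hmul : (c • N) * (c⁻¹ • N⁻¹) = 1 := by
    rw [Matrix.smul_mul, Matrix.mul_smul, smul_smul, mul_inv_cancel₀ hc, one_smul,
      Matrix.mul_nonsing_inv _ hdet]
  rw [Matrix.inv_eq_right_inv hmul]
  have hunit : IsUnit (c • N) :=
    (Matrix.isUnit_iff_isUnit_det _).2 (Matrix.isUnit_det_of_right_inverse hmul)
  set r : Fin (M + 1) → ℝ :=
    (1 - β) • Pi.single (fid M (l - 1)) 1 + β • Pi.single (fid M l) 1 with hr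
  have hrj (j : ℕ) (hj : 1 ≤ j) (hjM : j ≤ M) : r (fid M j) =
      (if j = l - 1 then 1 - β else 0) + (if j = l then β else 0) := by
    simp only [hr, Pi.add_apply, Pi.smul_apply, Pi.single_apply, smul_eq_mul, mul_ite, mul_one,
      mul_zero]
    simp only [fid_eq_iff hj (by omega : j ≤ M + 1) (by omega : 1 ≤ l) (by omega : l ≤ M + 1),
      fid_eq_iff hj (by omega : j ≤ M + 1) (by omega : 1 ≤ l - 1) (by omega : l - 1 ≤ M + 1)]
  have hval (v : Fin (M + 1)) : c * ((1 - β) * (c⁻¹ • N⁻¹) (fid M (l - 1)) v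
      + β * (c⁻¹ • N⁻¹) (fid M l) v) = Matrix.vecMul r N⁻¹ v := by
    simp only [hr, Matrix.add_vecMul, Matrix.smul_vecMul, Matrix.single_one_vecMul,
      Pi.add_apply, Pi.smul_apply, Matrix.row_apply, Matrix.smul_apply, smul_eq_mul]
    field_simp
  have hfid (u : Fin M) : fid M (u.1 + 1) = u.castSucc := by
    have := fid_val_succ (by omega : 1 ≤ u.1 + 1) (by omega : u.1 + 1 ≤ M + 1)
    rw [Fin.ext_iff, Fin.val_castSucc]
    omega
  have hcol {y : Fin (M + 1) → ℝ} (hy : ∀ u : Fin M, y u.castSucc = α * p (u.1 + 1)) :=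
    vecMul_Ntilde (t := t) (k := k) hlam (fun j h1 h2 => (hq j h1 h2).2.2) hy
  simp only [hval]
  constructor
  · rintro ⟨-, h⟩ j hj hjM
    rw [← hrj j hj hjM, ← hcol (y := Matrix.vecMul r N⁻¹) (fun u => ?_) j hj hjM,
      Matrix.vecMul_vecMul, Matrix.nonsing_inv_mul _ hdet, Matrix.vecMul_one]
    rw [← h (u.1 + 1) (by omega) (by omega), hfid]
  · intro h
    refine ⟨hunit, fun j hj hjM => ?_⟩
    set y : Fin (M + 1) → ℝ := Fin.snoc (fun u : Fin M => α * p (u.1 + 1))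
      (r (Fin.last M) - ∑ u : Fin M, α * p (u.1 + 1) * N u.castSucc (Fin.last M)) with hy
    have hyc (u : Fin M) : y u.castSucc = α * p (u.1 + 1) := by simp [hy]
    have hyN : Matrix.vecMul y N = r := by
      ext v
      induction v using Fin.lastCases with
      | last =>
        have h1 : N (Fin.last M) (Fin.last M) = 1 := by
          simp only [hN, Ntilde, Matrix.of_apply, NtE, Fin.val_last]
          rw [if_neg (by omega), if_pos trivial]
        simp only [Matrix.vecMul, dotProduct, Fin.sum_univ_castSucc, hyc, h1]
        simp [hy]
      | cast u =>
        rw [← hfid, hcol hyc _ (by omega) (by omega), h _ (by omega) (by omega),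
          hrj _ (by omega) (by omega)]
    rw [← hyN, Matrix.vecMul_vecMul, Matrix.mul_nonsing_inv _ hdet, Matrix.vecMul_one]
    have := hyc ⟨j - 1, by omega⟩
    rw [← hfid] at this
    simpa [Nat.sub_add_cancel hj] using this

/-- The ratio between `t λ_j p_j` and the potential at `κ_j`. -/
def gapWeight (κ : ℕ → ℝ) (j : ℕ) : ℝ :=
  (κ (j + 1) - κ j) * (κ j - κ (j - 1)) / (κ (j + 1) - κ (j - 1))

section MartingaleCoordinates

variable {M : ℕ} {i b k κ : ℕ → ℝ}

theorem MartCoord.lt_succ (hκ : MartCoord M i b κ) (j : ℕ) (hj : 1 ≤ j) (hjM : j < M) :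
    κ j < κ (j + 1) :=
  hκ.1 j hj (by omega)

theorem MartCoord.gaps_pos (hκ : MartCoord M i b κ) {j : ℕ} (hj : 2 ≤ j) (hjM : j ≤ M - 1) :
    0 < κ (j + 1) - κ j ∧ 0 < κ j - κ (j - 1) ∧ 0 < κ (j + 1) - κ (j - 1) := by
  have h1 := hκ.1 j (by omega) hjM
  have h2 := hκ.1 (j - 1) (by omega) (by omega)
  rw [Nat.sub_add_cancel (by omega)] at h2
  refine ⟨?_, ?_, ?_⟩ <;> linarith

theorem MartCoord.gapWeight_pos (hκ : MartCoord M i b κ) {j : ℕ} (hj : 2 ≤ j) (hjM : j ≤ M - 1) :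
    0 < gapWeight κ j := by
  obtain ⟨h1, h2, h3⟩ := hκ.gaps_pos hj hjM
  exact div_pos (mul_pos h1 h2) h3

theorem MartCoord.qup_qdn (hκ : MartCoord M i b κ) (j : ℕ) (hj : 2 ≤ j) (hjM : j ≤ M - 1) :
    0 ≤ qup i b j ∧ 0 ≤ qdn i b j ∧ qup i b j + qdn i b j = 1 := by
  obtain ⟨h1, h2, h3⟩ := hκ.gaps_pos hj hjM
  obtain ⟨h4, h5⟩ := hκ.2 j hj hjM
  rw [h4, h5]
  refine ⟨by positivity, by positivity, ?_⟩
  field_simp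
  ring

theorem ktil_nonneg (hi : ∀ j, 1 ≤ j → j ≤ M - 1 → i j < i (j + 1))
    (hk : ∀ j, 2 ≤ j → j ≤ M - 1 → 0 ≤ k j) (j : ℕ) : 0 ≤ ktil M i k j := by
  unfold ktil
  split_ifs with h
  · have h1 := hi j (by omega) h.2
    have h2 := hi (j - 1) (by omega) (by omega)
    rw [Nat.sub_add_cancel (by omega)] at h2
    exact mul_nonneg (mul_nonneg (by linarith) (by linarith)) (hk j h.1 h.2)
  · exact le_rfl

theorem ktil_div_gapWeight_nonneg (hκ : MartCoord M i b κ) (hkt : ∀ j, 0 ≤ ktil M i k j)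
    (j : ℕ) : 0 ≤ ktil M i k j / gapWeight κ j := by
  by_cases h : 2 ≤ j ∧ j ≤ M - 1
  · exact div_nonneg (hkt j) (hκ.gapWeight_pos h.1 h.2).le
  · simp [ktil, h]

theorem killed_mass_eq {t : ℝ} {lam p : ℕ → ℝ} (hκ : MartCoord M i b κ)
    (hlam : IntensityVec M lam) (a : ℕ) :
    p a * (1 + t * lam a * ktil M i k a) =
      p a + t * lam a * p a * gapWeight κ a * (ktil M i k a / gapWeight κ a) := by
  by_cases h : 2 ≤ a ∧ a ≤ M - 1
  · have := (hκ.gapWeight_pos h.1 h.2).ne'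
    field_simp
  · rw [hlam.2 a h]
    ring

theorem exists_admissible_step {lam x : ℕ → ℝ} (hlam : ∀ j, 1 ≤ j → j ≤ M → 0 ≤ lam j)
    (hx : ∀ j, 1 ≤ j → j ≤ M → 0 ≤ x j) :
    ∃ h : ℝ, 0 < h ∧ ∀ j, 1 ≤ j → j ≤ M → h * lam j * x j ≤ 1 := by
  have hterm : ∀ j ∈ Finset.Icc 1 M, 0 ≤ lam j * x j := fun j hj => by
    rw [Finset.mem_Icc] at hj
    exact mul_nonneg (hlam j hj.1 hj.2) (hx j hj.1 hj.2)
  have hpos : 0 < 1 + ∑ j ∈ Finset.Icc 1 M, lam j * x j := by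
    linarith [Finset.sum_nonneg hterm]
  refine ⟨(1 + ∑ j ∈ Finset.Icc 1 M, lam j * x j)⁻¹, inv_pos.2 hpos, fun j h1 h2 => ?_⟩
  rw [mul_assoc, inv_mul_le_one₀ hpos]
  linarith [Finset.single_le_sum hterm (Finset.mem_Icc.2 ⟨h1, h2⟩)]

theorem IntensityVec.nonneg {lam : ℕ → ℝ} (hlam : IntensityVec M lam) (j : ℕ) : 0 ≤ lam j := by
  by_cases h : 2 ≤ j ∧ j ≤ M - 1
  · exact hlam.1 j h.1 h.2
  · rw [hlam.2 j h]

theorem sol2_iff {t : ℝ} (ht : 0 < t) (hkt : ∀ j, 0 ≤ ktil M i k j) (hκ : MartCoord M i b κ)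
    {p lam g w : ℕ → ℝ} {α β : ℝ} {l : ℕ}
    (hg : ∀ j, g j = t * lam j * p j * gapWeight κ j)
    (hw : ∀ j, w j = p j + g j * (ktil M i k j / gapWeight κ j)) :
    Sol2 M t i b k κ p lam α l β ↔
      IntensityVec M lam ∧ 0 < α ∧ α ≤ 1 ∧ 2 ≤ l ∧ l ≤ M ∧ 0 < β ∧ β ≤ 1 ∧
      α * ∑ a ∈ Finset.Icc 1 M, w a = 1 ∧
      α * ∑ a ∈ Finset.Icc 1 M, κ a * w a = (1 - β) * κ (l - 1) + β * κ l ∧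
      (∀ j, 1 ≤ j → j ≤ l - 1 → g j = ∑ a ∈ Finset.Ico 1 j, (κ j - κ a) * w a) ∧
      (∀ j, l ≤ j → j ≤ M → g j = ∑ a ∈ Finset.Ioc j M, (κ a - κ j) * w a) := by
  unfold Sol2
  refine and_congr_right fun hlam => and_congr_right fun hα => and_congr_right fun _ =>
    and_congr_right fun hl => and_congr_right fun hlM => and_congr_right fun _ =>
    and_congr_right fun _ => ?_
  have hzero (j : ℕ) (hj : ¬(2 ≤ j ∧ j ≤ M - 1)) (c : ℝ) : t * lam j * p j * c = 0 := by
    rw [hlam.2 j hj]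
    ring
  have key := embedding_iff (κ := κ) (w := w) (g := g)
    (up := fun j => t * lam j * p j * qup i b j) (dn := fun j => t * lam j * p j * qdn i b j)
    (β := β) (by omega : 1 ≤ M) hl hlM hα hκ.lt_succ
    (fun j h1 h2 => by
      by_cases h : 2 ≤ j ∧ j ≤ M - 1
      · obtain ⟨-, -, h3⟩ := hκ.gaps_pos h.1 h.2
        rw [hg, (hκ.2 j h.1 h.2).1, gapWeight]
        field_simp
      · rw [hg, hzero j h, hzero j h, mul_zero])
    (fun j h1 h2 => by
      by_cases h : 2 ≤ j + 1 ∧ j + 1 ≤ M - 1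
      · obtain ⟨-, -, h3⟩ := hκ.gaps_pos h.1 h.2
        rw [hg, (hκ.2 (j + 1) h.1 h.2).2, gapWeight]
        rw [Nat.add_sub_cancel] at h3 ⊢
        field_simp
      · rw [hg, hzero _ h, hzero _ h, mul_zero])
    (hzero 0 (by omega) _) (hzero 1 (by omega) _) (hzero M (by omega) _)
    (hzero (M + 1) (by omega) _) (by rw [hg, hzero 1 (by omega)])
    (by rw [hg, hzero M (by omega)])
  rw [← key]
  have hlaw {h : ℝ} (hh : 0 < h) :=
    stopped_law_iff (α := α) (β := β) (p := p) hl hlM ht hh hlam hkt hκ.qup_qdn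
  have hwE (j : ℕ) : p j * (1 + t * lam j * ktil M i k j) = w j := by
    rw [killed_mass_eq hκ hlam, hw, hg]
  simp only [hwE] at hlaw
  constructor
  · intro H
    obtain ⟨h, hh, hadm⟩ := exists_admissible_step (M := M) (fun j _ _ => hlam.nonneg j)
      (fun j _ _ => add_nonneg zero_le_one (hkt j))
    exact (hlaw hh).1 (H h hh hadm)
  · exact fun H h hh _ => (hlaw hh).2 H

theorem Sol2.isPotential {t : ℝ} (ht : 0 < t) (hkt : ∀ j, 0 ≤ ktil M i k j)
    (hκ : MartCoord M i b κ) {p lam : ℕ → ℝ} {α β : ℝ} {l : ℕ}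
    (h : Sol2 M t i b k κ p lam α l β) :
    IsPotential M κ p (fun j => ktil M i k j / gapWeight κ j)
      (fun j => t * lam j * p j * gapWeight κ j) l := by
  obtain ⟨-, hα, -, hl, hlM, hβ, hβ1, hW, hK, hL, hR⟩ :=
    (sol2_iff ht hkt hκ (fun _ => rfl) (fun _ => rfl)).1 h
  have hgap : 0 < κ l - κ (l - 1) := by
    have := hκ.1 (l - 1) (by omega) (by omega)
    rw [Nat.sub_add_cancel (by omega)] at this
    linarith
  have hc (c : ℝ) (w : ℕ → ℝ) : α * ∑ a ∈ Finset.Icc 1 M, (κ a - c) * w a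
      = α * ∑ a ∈ Finset.Icc 1 M, κ a * w a - c * (α * ∑ a ∈ Finset.Icc 1 M, w a) := by
    simp only [sub_mul, Finset.sum_sub_distrib, ← Finset.mul_sum]
    ring
  refine ⟨hl, hlM, hL, hR, pos_of_mul_pos_right ?_ hα.le, nonpos_of_mul_nonpos_right ?_ hα⟩
  · rw [hc, hW, hK]
    nlinarith [mul_pos hβ hgap]
  · rw [hc, hW, hK]
    nlinarith [mul_nonneg (sub_nonneg.2 hβ1) hgap.le]

theorem Sol2.alpha_beta_eq {t : ℝ} (ht : 0 < t) (hkt : ∀ j, 0 ≤ ktil M i k j)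
    (hκ : MartCoord M i b κ) {p lam : ℕ → ℝ} {α β : ℝ} {l : ℕ}
    (hp : ∑ j ∈ Finset.Icc 1 M, p j = 1) (h : Sol2 M t i b k κ p lam α l β) :
    α = 1 / (1 + t * ∑ j ∈ Finset.Icc 1 M, p j * lam j * ktil M i k j) ∧
      Gx0 M t κ (ktil M i k) p lam = (1 - β) * κ (l - 1) + β * κ l ∧
      β = (Gx0 M t κ (ktil M i k) p lam - κ (l - 1)) / (κ l - κ (l - 1)) := by
  obtain ⟨hlam, hα, -, hl, hlM, hβ, hβ1, hW, hK, -⟩ :=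
    (sol2_iff ht hkt hκ (fun _ => rfl) (fun _ => rfl)).1 h
  have hgap : κ l - κ (l - 1) ≠ 0 := by
    have := hκ.1 (l - 1) (by omega) (by omega)
    rw [Nat.sub_add_cancel (by omega)] at this
    exact (sub_pos.2 this).ne'
  simp only [← killed_mass_eq hκ hlam] at hW hK
  have hx : Gx0 M t κ (ktil M i k) p lam = (1 - β) * κ (l - 1) + β * κ l := by
    simp only [Gx0, mul_assoc (κ _)]
    rw [eq_one_div_of_mul_eq_one_right hW, div_div_eq_mul_div, div_one, mul_comm, hK]
  refine ⟨?_, hx, ?_⟩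
  · have hs : ∑ a ∈ Finset.Icc 1 M, p a * (1 + t * lam a * ktil M i k a)
        = 1 + t * ∑ j ∈ Finset.Icc 1 M, p j * lam j * ktil M i k j := by
      conv_rhs => rw [← hp, Finset.mul_sum, ← Finset.sum_add_distrib]
      exact Finset.sum_congr rfl fun a _ => by ring
    rw [← hs]
    exact eq_one_div_of_mul_eq_one_left hW
  · rw [hx, eq_div_iff hgap]
    ring

theorem Sol2.gSystem {t : ℝ} (ht : 0 < t) (hkt : ∀ j, 0 ≤ ktil M i k j)
    (hκ : MartCoord M i b κ) {p lam : ℕ → ℝ} {α β : ℝ} {l : ℕ}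
    (hp : ProbVec M p) (h : Sol2 M t i b k κ p lam α l β) :
    GSystem M t κ (ktil M i k) p lam l := by
  obtain ⟨-, hx, -⟩ := h.alpha_beta_eq ht hkt hκ hp.2
  obtain ⟨hlam, -, -, hl, hlM, hβ, hβ1, -, -, hL, hR⟩ :=
    (sol2_iff ht hkt hκ (fun _ => rfl) (fun _ => rfl)).1 h
  have hgap : 0 < κ l - κ (l - 1) := by
    have := hκ.1 (l - 1) (by omega) (by omega)
    rw [Nat.sub_add_cancel (by omega)] at this
    linarith
  simp only [← killed_mass_eq hκ hlam, ← mul_assoc] at hL hR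
  have hinv (j : ℕ) (hj : 2 ≤ j) (hjM : j ≤ M - 1) : lam j = 1 / (t * p j) *
      ((κ (j + 1) - κ (j - 1)) / ((κ (j + 1) - κ j) * (κ j - κ (j - 1)))) *
        (t * lam j * p j * gapWeight κ j) := by
    obtain ⟨h1, h2, h3⟩ := hκ.gaps_pos hj hjM
    have h4 := hp.1 j (by omega) (by omega)
    rw [gapWeight]
    field_simp
  refine ⟨hl, hlM, fun j _ _ => hlam.nonneg j, hlam.2 1 (by omega), hlam.2 M (by omega), ?_, ?_,
    fun j h1 h2 => ?_, fun j h1 h2 => ?_⟩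
  · rw [hx]
    nlinarith [mul_pos hβ hgap]
  · rw [hx]
    nlinarith [mul_nonneg (sub_nonneg.2 hβ1) hgap.le]
  · have : Finset.Icc 1 (j - 1) = Finset.Ico 1 j := by
      rw [← Finset.Ico_add_one_right_eq_Icc, Nat.sub_add_cancel (by omega)]
    rw [this, ← hL j (by omega) h2]
    exact hinv j h1 (by omega)
  · rw [Finset.Icc_add_one_left_eq_Ioc, ← hR j h1 (by omega)]
    exact hinv j (by omega) h2

theorem Sol2.unique {t : ℝ} (ht : 0 < t) (hkt : ∀ j, 0 ≤ ktil M i k j)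
    (hκ : MartCoord M i b κ) {p lam lam' : ℕ → ℝ} {α α' β β' : ℝ} {l l' : ℕ}
    (hp : ProbVec M p) (h : Sol2 M t i b k κ p lam α l β)
    (h' : Sol2 M t i b k κ p lam' α' l' β') : lam = lam' ∧ α = α' ∧ l = l' ∧ β = β' := by
  obtain ⟨rfl, hgg⟩ := (h.isPotential ht hkt hκ).unique hκ.lt_succ hp.1
    (fun j _ _ => ktil_div_gapWeight_nonneg hκ hkt j) (h'.isPotential ht hkt hκ)
  obtain rfl : lam = lam' := by
    ext j
    by_cases hj : 2 ≤ j ∧ j ≤ M - 1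
    · have h1 := hgg j (by omega) (by omega)
      have h2 := (hκ.gapWeight_pos hj.1 hj.2).ne'
      have h3 := (hp.1 j (by omega) (by omega)).ne'
      exact mul_left_cancel₀ ht.ne' (mul_right_cancel₀ h3 (mul_right_cancel₀ h2 h1))
    · rw [h.1.2 j hj, h'.1.2 j hj]
  obtain ⟨ha, -, hb⟩ := h.alpha_beta_eq ht hkt hκ hp.2
  obtain ⟨ha', -, hb'⟩ := h'.alpha_beta_eq ht hkt hκ hp.2
  exact ⟨rfl, ha.trans ha'.symm, rfl, hb.trans hb'.symm⟩

theorem exists_sol2 (hM : 2 ≤ M) {t : ℝ} (ht : 0 < t) (hkt : ∀ j, 0 ≤ ktil M i k j)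
    (hκ : MartCoord M i b κ) {p : ℕ → ℝ} (hp : ProbVec M p) :
    ∃ lam α l β, Sol2 M t i b k κ p lam α l β := by
  have hρ := ktil_div_gapWeight_nonneg hκ hkt
  obtain ⟨g₀, l, hpot, hg0, hg1, hgM⟩ := exists_isPotential (M := M) hM hκ.lt_succ hp.1
    (fun j _ _ => hρ j)
  set lam : ℕ → ℝ := fun j =>
    if 2 ≤ j ∧ j ≤ M - 1 then g₀ j / (t * p j * gapWeight κ j) else 0 with hlamdef
  set g : ℕ → ℝ := fun j => t * lam j * p j * gapWeight κ j with hg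
  have hgg (j : ℕ) (h1 : 1 ≤ j) (h2 : j ≤ M) : g₀ j = g j := by
    by_cases hj : 2 ≤ j ∧ j ≤ M - 1
    · have h2 := hκ.gapWeight_pos hj.1 hj.2
      have h3 := hp.1 j (by omega) (by omega)
      simp only [hg, hlamdef, if_pos hj]
      field_simp
    · simp only [hg, hlamdef, if_neg hj]
      rcases (by omega : j = 1 ∨ j = M) with rfl | rfl
      · simp [hg1]
      · simp [hgM]
  have hlam : IntensityVec M lam := by
    refine ⟨fun j h1 h2 => ?_, fun j hj => if_neg hj⟩
    have h3 := hκ.gapWeight_pos h1 h2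
    have h4 := hp.1 j (by omega) (by omega)
    have h5 := hg0 j (by omega) (by omega)
    simp only [hlamdef, if_pos (And.intro h1 h2)]
    positivity
  set w : ℕ → ℝ := fun j => p j + g j * (ktil M i k j / gapWeight κ j) with hw
  rw [isPotential_iff] at hpot
  obtain ⟨hl, hlM, hL, hR, hx⟩ := hpot
  have hpot : IsPotential M κ p (fun j => ktil M i k j / gapWeight κ j) g l :=
    isPotential_iff.2 ⟨hl, hlM, fun j h1 h2 => by rw [← hgg j h1 (by omega), hL j h1 h2],
      fun j h1 h2 => by rw [← hgg j (by omega) h2, hR j h1 h2], hx⟩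
  obtain ⟨-, -, hL, hR, hlo, hhi⟩ := hpot
  have hW : 1 ≤ ∑ a ∈ Finset.Icc 1 M, w a := by
    rw [← hp.2]
    refine Finset.sum_le_sum fun a ha => ?_
    rw [Finset.mem_Icc] at ha
    have := mul_nonneg (hg0 a ha.1 ha.2) (hρ a)
    rw [hgg a ha.1 ha.2] at this
    simp only [hw]
    linarith
  have hc (c : ℝ) : ∑ a ∈ Finset.Icc 1 M, (κ a - c) * w a
      = ∑ a ∈ Finset.Icc 1 M, κ a * w a - c * ∑ a ∈ Finset.Icc 1 M, w a := by
    simp only [sub_mul, Finset.sum_sub_distrib, ← Finset.mul_sum]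
  change 0 < ∑ a ∈ Finset.Icc 1 M, (κ a - κ (l - 1)) * w a at hlo
  change ∑ a ∈ Finset.Icc 1 M, (κ a - κ l) * w a ≤ 0 at hhi
  rw [hc] at hlo hhi
  have hgap : 0 < κ l - κ (l - 1) := by
    have := hκ.1 (l - 1) (by omega) (by omega)
    rw [Nat.sub_add_cancel (by omega)] at this
    linarith
  set W := ∑ a ∈ Finset.Icc 1 M, w a
  set K := ∑ a ∈ Finset.Icc 1 M, κ a * w a
  have hWpos : 0 < W := by linarith
  refine ⟨lam, 1 / W, l, (K / W - κ (l - 1)) / (κ l - κ (l - 1)),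
    (sol2_iff ht hkt hκ (fun _ => rfl) (fun _ => rfl)).2 ⟨hlam, by positivity, ?_, hl, hlM, ?_, ?_,
      one_div_mul_cancel hWpos.ne', ?_, hL, hR⟩⟩
  · rw [div_le_one hWpos]
    exact hW
  · refine div_pos ?_ hgap
    rw [sub_pos, lt_div_iff₀ hWpos]
    linarith
  · rw [div_le_one hgap, sub_le_sub_iff_right, div_le_iff₀ hWpos]
    linarith
  · change 1 / W * K = _
    field_simp
    ring

end MartingaleCoordinates

/-- Existence and uniqueness of `(λ, α, l, β)` such that the discrete-time
chain with transition matrix `P̃^{(h)}(λ)` stopped at an independent geometric time of mean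
`t` has distribution `α·p`; moreover any solution satisfies the explicit formulas for `α`
and `β`, and `(λ, l)` solves the G-system with time parameter `t` and probability vector `p`. -/
theorem stmt_2 (M : ℕ) (hM : 3 ≤ M) (i b k κ p : ℕ → ℝ) (t : ℝ) (ht : 0 < t)
    (hi : ∀ j, 1 ≤ j → j ≤ M - 1 → i j < i (j + 1))
    (hb : DriftHyp M i b)
    (hk : ∀ j, 2 ≤ j → j ≤ M - 1 → 0 ≤ k j)
    (hκ : MartCoord M i b κ)
    (hp : ProbVec M p) :
    (∃! q : (ℕ → ℝ) × ℝ × ℕ × ℝ, Sol2 M t i b k κ p q.1 q.2.1 q.2.2.1 q.2.2.2) ∧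
    (∀ lam α l β, Sol2 M t i b k κ p lam α l β →
      α = 1 / (1 + t * ∑ j ∈ Finset.Icc 1 M, p j * lam j * ktil M i k j) ∧
      β = ((∑ j ∈ Finset.Icc 1 M, κ j * p j * (1 + t * lam j * ktil M i k j)) /
              (∑ j ∈ Finset.Icc 1 M, p j * (1 + t * lam j * ktil M i k j))
            - κ (l - 1)) / (κ l - κ (l - 1)) ∧
      GSystem M t κ (ktil M i k) p lam l) := by
  have hkt := ktil_nonneg hi hk
  refine ⟨?_, fun lam α l β h => ?_⟩
  · obtain ⟨lam, α, l, β, h⟩ := exists_sol2 (by omega) ht hkt hκ hp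
    refine ⟨(lam, α, l, β), h, ?_⟩
    rintro ⟨lam', α', l', β'⟩ h'
    obtain ⟨rfl, rfl, rfl, rfl⟩ := h.unique ht hkt hκ hp h'
    rfl
  · obtain ⟨h1, -, h2⟩ := h.alpha_beta_eq ht hkt hκ hp.2
    exact ⟨h1, h2, h.gSystem ht hkt hκ hp⟩
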